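/- For any A,B ∈ Aut_{mHH}(H), the vector space H_{(A,B)} = H with right H-Hom-comodule structure given by the comultiplication Δ, and left H-action h·x = (B(h₂)α⁻¹(x))·A(S⁻¹(α(h₁))), is a left-right (A,B)-Yetter-Drinfeld Hom-module over (H,α). -/

import Mathlib

open TensorProduct

/-- A monoidal Hom-Hopf algebra (with bijective antipode) over a field `k`. -/
structure HomHopf (k : Type*) [Field k] (H : Type*) [AddCommGroup H] [Module k H] where
  mul : H →ₗ[k] H →ₗ[k] H
  one : H
  a : H ≃ₗ[k] H
  comul : H →ₗ[k] H ⊗[k] H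
  counit : H →ₗ[k] k
  S : H ≃ₗ[k] H
  hom_assoc : ∀ x y z : H, mul (a x) (mul y z) = mul (mul x y) (a z)
  a_mul : ∀ x y : H, a (mul x y) = mul (a x) (a y)
  mul_one' : ∀ x : H, mul x one = a x
  one_mul' : ∀ x : H, mul one x = a x
  a_one : a one = one
  hom_coassoc : (TensorProduct.map a.symm.toLinearMap comul).comp comul
      = (TensorProduct.assoc k H H H).toLinearMap.comp
          ((TensorProduct.map comul a.symm.toLinearMap).comp comul)
  comul_a : ∀ x : H, comul (a x) = TensorProduct.map a.toLinearMap a.toLinearMap (comul x)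
  counit_comul : ∀ x : H,
    (TensorProduct.lid k H) ((TensorProduct.map counit LinearMap.id) (comul x)) = a.symm x
  comul_counit : ∀ x : H,
    (TensorProduct.rid k H) ((TensorProduct.map LinearMap.id counit) (comul x)) = a.symm x
  counit_a : ∀ x : H, counit (a x) = counit x
  comul_mul : ∀ x y : H, comul (mul x y)
      = (TensorProduct.map (TensorProduct.lift mul) (TensorProduct.lift mul))
          ((TensorProduct.tensorTensorTensorComm k H H H H) (comul x ⊗ₜ[k] comul y))
  comul_one : comul one = one ⊗ₜ[k] one
  counit_mul : ∀ x y : H, counit (mul x y) = counit x * counit y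
  counit_one : counit one = 1
  S_a : ∀ x : H, S (a x) = a (S x)
  antipode_left : ∀ x : H,
    (TensorProduct.lift mul) ((TensorProduct.map S.toLinearMap LinearMap.id) (comul x))
      = counit x • one
  antipode_right : ∀ x : H,
    (TensorProduct.lift mul) ((TensorProduct.map LinearMap.id S.toLinearMap) (comul x))
      = counit x • one

/-- A monoidal Hom-Hopf algebra automorphism. -/
structure IsHomHopfAuto {k : Type*} [Field k] {H : Type*} [AddCommGroup H] [Module k H]
    (HH : HomHopf k H) (f : H ≃ₗ[k] H) : Prop where
  map_mul : ∀ x y : H, f (HH.mul x y) = HH.mul (f x) (f y)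
  map_one : f HH.one = HH.one
  map_comul : ∀ x : H, HH.comul (f x)
      = TensorProduct.map f.toLinearMap f.toLinearMap (HH.comul x)
  map_counit : ∀ x : H, HH.counit (f x) = HH.counit x
  map_a : ∀ x : H, f (HH.a x) = HH.a (f x)

/-- A left-right (A,B)-Yetter-Drinfeld Hom-module over `HH`. -/
structure YDModule {k : Type*} [Field k] {H : Type*} [AddCommGroup H] [Module k H]
    (HH : HomHopf k H) (A B : H ≃ₗ[k] H)
    (M : Type*) [AddCommGroup M] [Module k M] where
  act : H →ₗ[k] M →ₗ[k] M
  coact : M →ₗ[k] M ⊗[k] H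
  mu : M ≃ₗ[k] M
  hom_act : ∀ (h g : H) (m : M), act (HH.a h) (act g m) = act (HH.mul h g) (mu m)
  mu_act : ∀ (h : H) (m : M), mu (act h m) = act (HH.a h) (mu m)
  one_act : ∀ m : M, act HH.one m = mu m
  hom_coact : (TensorProduct.map mu.symm.toLinearMap HH.comul).comp coact
      = (TensorProduct.assoc k M H H).toLinearMap.comp
          ((TensorProduct.map coact HH.a.symm.toLinearMap).comp coact)
  coact_mu : ∀ m : M, coact (mu m)
      = TensorProduct.map mu.toLinearMap HH.a.toLinearMap (coact m)
  coact_counit : ∀ m : M,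
    (TensorProduct.rid k M) ((TensorProduct.map LinearMap.id HH.counit) (coact m)) = mu.symm m
  compat : ∀ (h : H) (m : M) (n : ℕ) (h1 h2 : Fin n → H),
      HH.comul h = ∑ i, h1 i ⊗ₜ[k] h2 i →
      ∀ (p : ℕ) (h21 h22 : Fin n → Fin p → H),
      (∀ i, HH.comul (h2 i) = ∑ j, h21 i j ⊗ₜ[k] h22 i j) →
      ∀ (q : ℕ) (m0 : Fin q → M) (m1 : Fin q → H),
      coact m = ∑ l, m0 l ⊗ₜ[k] m1 l →
      coact (act h m) = ∑ i, ∑ j, ∑ l,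
        act (HH.a (h21 i j)) (m0 l) ⊗ₜ[k]
          HH.mul (HH.mul (B (h22 i j)) (HH.a.symm (m1 l))) (A (HH.S.symm (h1 i)))

open Coalgebra in
/-- Four-fold coassociativity: `(h₁₁ ⊗ h₁₂) ⊗ (h₂₁ ⊗ h₂₂) = (h₁ ⊗ h₂₁₁) ⊗ (h₂₁₂ ⊗ h₂₂)`. -/
theorem TensorProduct.map_comul_comul_comul {R C : Type*} [CommSemiring R] [AddCommMonoid C]
    [Module R C] [Coalgebra R C] (h : C) :
    TensorProduct.map comul comul (comul (R := R) h) =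
      (TensorProduct.assoc R C C (C ⊗[R] C)).symm
        (((TensorProduct.assoc R C C C).toLinearMap ∘ₗ comul.rTensor C ∘ₗ comul).lTensor C
          (comul h)) := by
  rw [LinearEquiv.eq_symm_apply, coassoc, LinearMap.lTensor_comp, LinearMap.comp_apply,
    ← coassoc_apply]
  generalize comul (R := R) h = z
  induction z with
  | zero => simp
  | add x y hx hy => simp only [map_add, hx, hy]
  | tmul x y =>
    simp only [TensorProduct.map_tmul, LinearMap.rTensor_tmul]
    generalize comul (R := R) x = w
    induction w with
    | zero => simp
    | add x y hx hy => simp only [map_add, hx, hy, TensorProduct.add_tmul]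
    | tmul x y => simp

open Coalgebra in
theorem TensorProduct.map_comul_comul_comul_repr {R C ι κ : Type*} {Λ : κ → Type*} [CommSemiring R]
    [AddCommMonoid C] [Module R C] [Coalgebra R C] {h : C} (r : Repr R h ι)
    (s : ∀ i, Repr R (r.right i) κ) (t : ∀ i j, Repr R ((s i).left j) (Λ j)) :
    TensorProduct.map comul comul (comul (R := R) h) =
      ∑ i ∈ r.index, ∑ j ∈ (s i).index, ∑ l ∈ (t i j).index,
        (r.left i ⊗ₜ[R] (t i j).left l) ⊗ₜ[R] ((t i j).right l ⊗ₜ[R] (s i).right j) := by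
  rw [map_comul_comul_comul, ← r.eq]
  simp [← (s _).eq, ← (t _ _).eq, TensorProduct.tmul_sum, TensorProduct.sum_tmul]

namespace HopfAlgebra

open Coalgebra LinearMap WithConv

variable {R C : Type*} [CommSemiring R] [Semiring C] [HopfAlgebra R C]

theorem comul_antipode_left_inv :
    toConv (TensorProduct.map (antipode R) (antipode R) ∘ₗ
      (TensorProduct.comm R C C).toLinearMap ∘ₗ comul) * toConv comul = 1 := by
  ext h
  have key : ((toConv (TensorProduct.map (antipode R) (antipode R) ∘ₗ
      (TensorProduct.comm R C C).toLinearMap ∘ₗ comul) * toConv comul :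
        WithConv (C →ₗ[R] C ⊗[R] C))) h =
      LinearMap.mul' R (C ⊗[R] C) (TensorProduct.map
        (TensorProduct.map (antipode R) (antipode R) ∘ₗ (TensorProduct.comm R C C).toLinearMap) id
        (TensorProduct.map comul comul (comul (R := R) h))) := by
    change LinearMap.mul' R (C ⊗[R] C) (TensorProduct.map ((TensorProduct.map (antipode R)
      (antipode R) ∘ₗ (TensorProduct.comm R C C).toLinearMap) ∘ₗ comul) (id ∘ₗ comul)
        (comul h)) = _
    rw [TensorProduct.map_comp]
    rfl
  rw [key, TensorProduct.map_comul_comul_comul_repr (ℛ R h) (fun _ => ℛ R _) (fun _ _ => ℛ R _)]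
  simp only [map_sum, TensorProduct.map_tmul, LinearMap.comp_apply, LinearEquiv.coe_coe,
    TensorProduct.comm_tmul, LinearMap.mul'_apply, Algebra.TensorProduct.tmul_mul_tmul, id_apply,
    ← TensorProduct.sum_tmul, sum_antipode_mul_eq_smul, TensorProduct.smul_tmul,
    ← mul_smul_comm, ← TensorProduct.tmul_sum, ← Finset.mul_sum, sum_counit_smul]
  simp [Algebra.TensorProduct.one_def, Algebra.algebraMap_eq_smul_one, TensorProduct.tmul_smul]

theorem comul_antipode (h : C) :
    comul (antipode R h) = TensorProduct.map (antipode R) (antipode R)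
      (TensorProduct.comm R C C (comul h)) :=
  (LinearMap.congr_fun (congrArg ofConv (left_inv_eq_right_inv
    (comul_antipode_left_inv (R := R) (C := C)) LinearMap.comul_right_inv)) h).symm

end HopfAlgebra

section Sandwich

open Coalgebra

variable {R C E : Type*} [CommSemiring R] [AddCommMonoid C] [Module R C] [Semiring E] [Algebra R E]

/-- The linear map `u ⊗ v ↦ (x ↦ g v * x * f u)`. -/
noncomputable def sandwich (f g : C →ₗ[R] E) :
    C ⊗[R] C →ₗ[R] E →ₗ[R] E :=
  TensorProduct.lift ((LinearMap.mul R (Module.End R E)).compl₁₂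
    ((LinearMap.mul R E).flip ∘ₗ f) (LinearMap.mul R E ∘ₗ g))

@[simp]
theorem sandwich_tmul (f g : C →ₗ[R] E) (u v : C)
    (x : E) : sandwich f g (u ⊗ₜ v) x = g v * x * f u := by
  simp [sandwich]

end Sandwich

section TwistedAdjoint

open Coalgebra

variable {R H : Type*} [CommSemiring R] [Semiring H] [Bialgebra R H]

/-- The action `h ▸ m = B h₂ * m * T h₁`. -/
noncomputable def twistedAd (B T : H →ₗ[R] H) : H →ₗ[R] H →ₗ[R] H :=
  sandwich T B ∘ₗ comul

variable {B T : H →ₗ[R] H}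

theorem twistedAd_repr {ι : Type*} {h : H} (r : Repr R h ι) (m : H) :
    twistedAd B T h m = ∑ i ∈ r.index, B (r.right i) * m * T (r.left i) := by
  simp [twistedAd, ← r.eq]

theorem twistedAd_one (hB : B 1 = 1) (hT : T 1 = 1) (m : H) : twistedAd B T 1 m = m := by
  simp [twistedAd, Algebra.TensorProduct.one_def, hB, hT]

theorem twistedAd_mul (hB : ∀ x y, B (x * y) = B x * B y) (hT : ∀ x y, T (x * y) = T y * T x)
    (h g m : H) : twistedAd B T (h * g) m = twistedAd B T h (twistedAd B T g m) := by
  rw [twistedAd_repr ((ℛ R h).mul (ℛ R g)), twistedAd_repr (ℛ R h), twistedAd_repr (ℛ R g)]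
  simp [Finset.sum_product, Finset.mul_sum, Finset.sum_mul, hB, hT, mul_assoc]

theorem map_twistedAd {f : H →ₗ[R] H} (hf : ∀ x y, f (x * y) = f x * f y)
    (hfc : ∀ x, comul (R := R) (f x) = TensorProduct.map f f (comul x))
    (hB : ∀ x, f (B x) = B (f x)) (hT : ∀ x, f (T x) = T (f x)) (h m : H) :
    f (twistedAd B T h m) = twistedAd B T (f h) (f m) := by
  rw [twistedAd_repr (ℛ R h), twistedAd, LinearMap.comp_apply, hfc, ← (ℛ R h).eq]
  simp [hf, hB, hT]

theorem comul_twistedAd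
    (hBc : ∀ x, comul (R := R) (B x) = TensorProduct.map B B (comul x))
    (hTc : ∀ x, comul (R := R) (T x) =
      TensorProduct.map T T (TensorProduct.comm R H H (comul x)))
    {ι κ Λ : Type*} {h m : H} (r : Repr R h ι) (s : ∀ i, Repr R (r.right i) κ)
    (t : Repr R m Λ) :
    comul (R := R) (twistedAd B T h m) =
      ∑ i ∈ r.index, ∑ j ∈ (s i).index, ∑ l ∈ t.index,
        twistedAd B T ((s i).left j) (t.left l) ⊗ₜ[R]
          (B ((s i).right j) * t.right l * T (r.left i)) := by
  have key : comul (R := R) (twistedAd B T h m) =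
      sandwich (TensorProduct.map T T ∘ₗ (TensorProduct.comm R H H).toLinearMap)
        (TensorProduct.map B B) (TensorProduct.map comul comul (comul (R := R) h))
        (comul (R := R) m) := by
    rw [twistedAd_repr (ℛ R h), ← (ℛ R h).eq]
    simp [hBc, hTc]
  rw [key, TensorProduct.map_comul_comul_comul_repr r s (fun _ _ => ℛ R _)]
  simp only [twistedAd_repr (ℛ R _), ← t.eq, map_sum, LinearMap.sum_apply, sandwich_tmul,
    TensorProduct.map_tmul, LinearMap.comp_apply, LinearEquiv.coe_coe, TensorProduct.comm_tmul,
    Algebra.TensorProduct.tmul_mul_tmul, TensorProduct.sum_tmul]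
  exact Finset.sum_comm.trans (Finset.sum_congr rfl fun _ _ => Finset.sum_comm)

end TwistedAdjoint

namespace HomHopf

section Untwist

variable {k : Type*} [Field k] {H : Type*} [AddCommGroup H] [Module k H] (HH : HomHopf k H)

theorem a_symm_mul (x y : H) :
    HH.a.symm (HH.mul x y) = HH.mul (HH.a.symm x) (HH.a.symm y) := by
  rw [LinearEquiv.symm_apply_eq, HH.a_mul]; simp

theorem a_symm_one : HH.a.symm HH.one = HH.one := by
  rw [LinearEquiv.symm_apply_eq, HH.a_one]

/-- The associative ring with product `x * y = α⁻¹ (x y)`. -/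
abbrev untwistRing : Ring H :=
  { ‹AddCommGroup H› with
    mul := fun x y => HH.a.symm (HH.mul x y)
    one := HH.one
    mul_assoc := fun x y z => by
      change HH.a.symm (HH.mul (HH.a.symm (HH.mul x y)) z) =
        HH.a.symm (HH.mul x (HH.a.symm (HH.mul y z)))
      apply congrArg
      apply HH.a.injective
      simp only [HH.a_mul, LinearEquiv.apply_symm_apply]
      exact (HH.hom_assoc x y z).symm
    one_mul := fun x => by
      change HH.a.symm (HH.mul HH.one x) = x
      simp [HH.one_mul']
    mul_one := fun x => by
      change HH.a.symm (HH.mul x HH.one) = x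
      simp [HH.mul_one']
    left_distrib := fun x y z => by
      change HH.a.symm (HH.mul x (y + z)) = HH.a.symm (HH.mul x y) + HH.a.symm (HH.mul x z)
      simp
    right_distrib := fun x y z => by
      change HH.a.symm (HH.mul (x + y) z) = HH.a.symm (HH.mul x z) + HH.a.symm (HH.mul y z)
      simp
    zero_mul := fun x => by
      change HH.a.symm (HH.mul 0 x) = 0
      simp
    mul_zero := fun x => by
      change HH.a.symm (HH.mul x 0) = 0
      simp }

/-- The algebra structure on `HH.untwistRing`. -/
abbrev untwistAlgebra : letI := HH.untwistRing; Algebra k H :=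
  letI := HH.untwistRing
  Algebra.ofModule
    (fun r x y => by
      change HH.a.symm (HH.mul (r • x) y) = r • HH.a.symm (HH.mul x y)
      simp)
    (fun r x y => by
      change HH.a.symm (HH.mul x (r • y)) = r • HH.a.symm (HH.mul x y)
      simp)

/-- The coassociative coalgebra with coproduct `x ↦ α x₁ ⊗ α x₂`. -/
abbrev untwistCoalgebra : Coalgebra k H where
  comul := HH.comul ∘ₗ HH.a.toLinearMap
  counit := HH.counit
  coassoc := by
    ext x
    obtain ⟨y, rfl⟩ := HH.a.symm.surjective x
    simp only [LinearMap.comp_apply, LinearEquiv.coe_coe, LinearEquiv.apply_symm_apply]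
    have key := congrArg (TensorProduct.map HH.a.toLinearMap
      (TensorProduct.map HH.a.toLinearMap HH.a.toLinearMap)) (LinearMap.congr_fun HH.hom_coassoc y).symm
    simp only [LinearMap.comp_apply, LinearEquiv.coe_coe] at key
    rw [TensorProduct.map_map_assoc] at key
    convert key using 1
    · congr 1
      generalize HH.comul y = z
      induction z with
      | zero => simp
      | add u v hu hv => simp only [map_add, hu, hv]
      | tmul u v => simp [HH.comul_a]
    · generalize HH.comul y = z
      induction z with
      | zero => simp
      | add u v hu hv => simp only [map_add, hu, hv]
      | tmul u v => simp [HH.comul_a]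
  rTensor_counit_comp_comul := by
    ext x
    apply (TensorProduct.lid k H).injective
    have := HH.counit_comul (HH.a x)
    simpa [LinearMap.rTensor] using this
  lTensor_counit_comp_comul := by
    ext x
    apply (TensorProduct.rid k H).injective
    have := HH.comul_counit (HH.a x)
    simpa [LinearMap.lTensor] using this

/-- The bialgebra structure on `HH.untwistRing`. -/
abbrev untwistBialgebra : letI := HH.untwistRing; Bialgebra k H :=
  letI := HH.untwistRing
  letI := HH.untwistAlgebra
  letI : Coalgebra k H := HH.untwistCoalgebra
  Bialgebra.mk' k H HH.counit_one
    (fun {x y} => by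
      change HH.counit (HH.a.symm (HH.mul x y)) = HH.counit x * HH.counit y
      rw [← HH.counit_a, LinearEquiv.apply_symm_apply, HH.counit_mul])
    (by
      change HH.comul (HH.a HH.one) = HH.one ⊗ₜ[k] HH.one
      rw [HH.a_one, HH.comul_one])
    (fun {x y} => by
      change HH.comul (HH.a (HH.a.symm (HH.mul x y))) =
        HH.comul (HH.a x) * HH.comul (HH.a y)
      rw [LinearEquiv.apply_symm_apply, HH.comul_mul, HH.comul_a, HH.comul_a]
      generalize HH.comul x = u
      generalize HH.comul y = v
      induction u with
      | zero => simp
      | add u w hu hw => simp only [map_add, TensorProduct.add_tmul, add_mul, hu, hw]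
      | tmul u₁ u₂ =>
        induction v with
        | zero => simp
        | add u w hu hw => simp only [map_add, TensorProduct.tmul_add, mul_add, hu, hw]
        | tmul v₁ v₂ =>
          simp only [TensorProduct.tensorTensorTensorComm_tmul, TensorProduct.map_tmul,
            TensorProduct.lift.tmul, LinearEquiv.coe_coe, Algebra.TensorProduct.tmul_mul_tmul]
          change _ = HH.a.symm (HH.mul (HH.a u₁) (HH.a v₁)) ⊗ₜ[k]
            HH.a.symm (HH.mul (HH.a u₂) (HH.a v₂))
          simp [a_symm_mul])

theorem mul'_untwist (z : H ⊗[k] H) :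
    letI := HH.untwistRing
    letI := HH.untwistAlgebra
    LinearMap.mul' k H z = HH.a.symm (TensorProduct.lift HH.mul z) := by
  induction z with
  | zero => simp
  | add u w hu hw => simp only [map_add, hu, hw]
  | tmul u v => rfl

/-- The Hopf algebra structure on `HH.untwistRing`. -/
abbrev untwistHopfAlgebra : letI := HH.untwistRing; HopfAlgebra k H :=
  letI := HH.untwistRing
  { HH.untwistBialgebra with
    antipode := HH.S.toLinearMap
    mul_antipode_rTensor_comul := by
      ext x
      have := congrArg HH.a.symm (HH.antipode_left (HH.a x))
      rw [HH.counit_a, map_smul, HH.a_symm_one] at this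
      refine Eq.trans ?_ (this.trans
        (@Algebra.algebraMap_eq_smul_one k H _ HH.untwistRing.toSemiring HH.untwistAlgebra
          (HH.counit x)).symm)
      exact HH.mul'_untwist _
    mul_antipode_lTensor_comul := by
      ext x
      have := congrArg HH.a.symm (HH.antipode_right (HH.a x))
      rw [HH.counit_a, map_smul, HH.a_symm_one] at this
      refine Eq.trans ?_ (this.trans
        (@Algebra.algebraMap_eq_smul_one k H _ HH.untwistRing.toSemiring HH.untwistAlgebra
          (HH.counit x)).symm)
      exact HH.mul'_untwist _ }

end Untwist

end HomHopf

section Twist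

open HopfAlgebra

variable {k : Type*} [Field k] {H : Type*} [Ring H] [HopfAlgebra k H]

/-- The Hom-Hopf algebra `HH` is the twist of the Hopf algebra `H` by `HH.a`. -/
structure IsHopfTwist (HH : HomHopf k H) : Prop where
  mul_eq : ∀ x y, HH.mul x y = HH.a (x * y)
  one_eq : HH.one = 1
  comul_eq : ∀ x, Coalgebra.comul (R := k) x =
    TensorProduct.map HH.a.toLinearMap HH.a.toLinearMap (HH.comul x)
  S_eq : ∀ x, HH.S x = antipode k x

theorem TensorProduct.exists_fin_sum_tmul {R M N : Type*} [CommSemiring R] [AddCommMonoid M]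
    [AddCommMonoid N] [Module R M] [Module R N] (z : M ⊗[R] N) :
    ∃ (n : ℕ) (x : Fin n → M) (y : Fin n → N), z = ∑ i, x i ⊗ₜ[R] y i := by
  obtain ⟨s, hs⟩ := TensorProduct.exists_finset z
  refine ⟨s.card, fun i => (s.equivFin.symm i).1.1, fun i => (s.equivFin.symm i).1.2, ?_⟩
  rw [hs, ← Finset.sum_coe_sort]
  exact (Equiv.sum_comp s.equivFin.symm fun p : s => p.1.1 ⊗ₜ[R] p.1.2).symm

namespace IsHopfTwist

variable {HH : HomHopf k H}

theorem a_mul (hH : IsHopfTwist HH) (x y : H) : HH.a (x * y) = HH.a x * HH.a y := by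
  apply HH.a.injective
  rw [← hH.mul_eq, ← hH.mul_eq, HH.a_mul]

theorem comul_a (hH : IsHopfTwist HH) (x : H) : HH.comul (HH.a x) = Coalgebra.comul x := by
  rw [hH.comul_eq, HH.comul_a]

theorem auto_mul (hH : IsHopfTwist HH) {f : H ≃ₗ[k] H} (hf : IsHomHopfAuto HH f) (x y : H) :
    f (x * y) = f x * f y := by
  apply HH.a.injective
  rw [← hH.mul_eq, ← hf.map_mul, ← hf.map_a, hH.mul_eq]

theorem auto_comul (hH : IsHopfTwist HH) {f : H ≃ₗ[k] H} (hf : IsHomHopfAuto HH f) (x : H) :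
    Coalgebra.comul (R := k) (f x) =
      TensorProduct.map f.toLinearMap f.toLinearMap (Coalgebra.comul x) := by
  rw [← hH.comul_a, ← hf.map_a, hf.map_comul, hH.comul_a]

theorem S_symm_mul (hH : IsHopfTwist HH) (x y : H) :
    HH.S.symm (x * y) = HH.S.symm y * HH.S.symm x := by
  rw [LinearEquiv.symm_apply_eq, hH.S_eq, antipode_mul_antidistrib, ← hH.S_eq, ← hH.S_eq]
  simp

theorem S_symm_one (hH : IsHopfTwist HH) : HH.S.symm 1 = 1 := by
  rw [LinearEquiv.symm_apply_eq, hH.S_eq, antipode_one]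

theorem comul_S_symm (hH : IsHopfTwist HH) (x : H) :
    Coalgebra.comul (R := k) (HH.S.symm x) =
      TensorProduct.map HH.S.symm.toLinearMap HH.S.symm.toLinearMap
        (TensorProduct.comm k H H (Coalgebra.comul x)) := by
  obtain ⟨y, rfl⟩ := HH.S.surjective x
  have hS : antipode k (A := H) = HH.S.toLinearMap := LinearMap.ext fun x => (hH.S_eq x).symm
  rw [LinearEquiv.symm_apply_apply, hH.S_eq, comul_antipode, hS]
  generalize Coalgebra.comul (R := k) y = z
  induction z with
  | zero => simp
  | add u v hu hv => simp only [map_add, ← hu, ← hv]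
  | tmul u v => simp

theorem S_symm_a (x : H) : HH.S.symm (HH.a x) = HH.a (HH.S.symm x) := by
  rw [LinearEquiv.symm_apply_eq, HH.S_a, LinearEquiv.apply_symm_apply]

/-- A representation of the Hom-comultiplication gives one of the comultiplication. -/
def repr (hH : IsHopfTwist HH) {h : H} {n : ℕ} {h1 h2 : Fin n → H}
    (hh : HH.comul h = ∑ i, h1 i ⊗ₜ[k] h2 i) : Coalgebra.Repr k h (Fin n) where
  index := Finset.univ
  left := fun i => HH.a (h1 i)
  right := fun i => HH.a (h2 i)
  eq := by rw [hH.comul_eq, hh]; simp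

/-- A representation of the Hom-comultiplication of `h` gives one of the comultiplication
of `HH.a h`. -/
def reprA (hH : IsHopfTwist HH) {h : H} {n : ℕ} {h1 h2 : Fin n → H}
    (hh : HH.comul h = ∑ i, h1 i ⊗ₜ[k] h2 i) : Coalgebra.Repr k (HH.a h) (Fin n) where
  index := Finset.univ
  left := fun i => HH.a (HH.a (h1 i))
  right := fun i => HH.a (HH.a (h2 i))
  eq := by rw [hH.comul_eq, HH.comul_a, hh]; simp

theorem exists_ydModule (hH : IsHopfTwist HH) (A B : H ≃ₗ[k] H)
    (hA : IsHomHopfAuto HH A) (hB : IsHomHopfAuto HH B)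
    (act : H →ₗ[k] H →ₗ[k] H)
    (hact : ∀ (h x : H) (n : ℕ) (h1 h2 : Fin n → H),
      HH.comul h = ∑ i, h1 i ⊗ₜ[k] h2 i →
      act h x = ∑ i, HH.mul (HH.mul (B (h2 i)) (HH.a.symm x)) (A (HH.S.symm (HH.a (h1 i))))) :
    ∃ Y : YDModule HH A B H, Y.act = act ∧ Y.coact = HH.comul ∧ Y.mu = HH.a := by
  let T : H →ₗ[k] H := A.toLinearMap ∘ₗ HH.S.symm.toLinearMap
  let D := twistedAd B.toLinearMap T
  have hTm (x y : H) : T (x * y) = T y * T x := by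
    simp [T, hH.S_symm_mul, hH.auto_mul hA]
  have hTa (x : H) : HH.a (T x) = T (HH.a x) := by
    simp [T, S_symm_a, hA.map_a]
  have hTc (x : H) : Coalgebra.comul (R := k) (T x) =
      TensorProduct.map T T (TensorProduct.comm k H H (Coalgebra.comul x)) := by
    simp only [T, TensorProduct.map_comp]
    simp [hH.auto_comul hA, hH.comul_S_symm]
  have hDa (h m : H) : HH.a (D h m) = D (HH.a h) (HH.a m) :=
    map_twistedAd (f := HH.a.toLinearMap) hH.a_mul
      (fun x => by rw [LinearEquiv.coe_coe, ← hH.comul_a, HH.comul_a, hH.comul_a])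
      (fun x => (hB.map_a x).symm) hTa h m
  have hD (h m : H) : act h m = HH.a (D h m) := by
    obtain ⟨n, h1, h2, hh⟩ := TensorProduct.exists_fin_sum_tmul (HH.comul h)
    rw [hact h m n h1 h2 hh]
    simp only [D, twistedAd_repr (hH.repr hh)]
    simp [repr, hH.mul_eq, hH.a_mul, hB.map_a, T]
  refine ⟨⟨act, HH.comul, HH.a, ?_, ?_, ?_, HH.hom_coassoc, HH.comul_a, HH.comul_counit, ?_⟩,
    rfl, rfl, rfl⟩
  · intro h g m
    rw [hD, hD, hD, ← hDa, hH.mul_eq, ← hDa]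
    exact congrArg (fun x => HH.a (HH.a x))
      (twistedAd_mul (hH.auto_mul hB) hTm h g m).symm
  · intro h m
    rw [hD, hD, hDa]
  · intro m
    rw [hD, hH.one_eq]
    exact congrArg HH.a (twistedAd_one (by simpa [hH.one_eq] using hB.map_one)
      (by simpa [T, hH.S_symm_one, hH.one_eq] using hA.map_one) m)
  · intro h m n h1 h2 hh p h21 h22 hh2 q m0 m1 hm
    rw [hD, hH.comul_a]
    simp only [D]
    rw [comul_twistedAd (hH.auto_comul hB) hTc (hH.repr hh) (fun i => hH.reprA (hh2 i))
      (hH.repr hm)]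
    simp only [hD, hDa]
    simp [repr, reprA, D, hH.mul_eq, hH.a_mul, hB.map_a, T, S_symm_a, hA.map_a]

end IsHopfTwist

end Twist

theorem HomHopf.isHopfTwist_untwist {k : Type*} [Field k] {H : Type*} [AddCommGroup H]
    [Module k H] (HH : HomHopf k H) :
    @IsHopfTwist k _ H HH.untwistRing HH.untwistHopfAlgebra HH :=
  @IsHopfTwist.mk k _ H HH.untwistRing HH.untwistHopfAlgebra HH
    (fun x y => (HH.a.apply_symm_apply (HH.mul x y)).symm) rfl HH.comul_a (fun _ => rfl)

/-- H_{(A,B)} = H with right coaction Δ and left action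
h·x = (B(h₂)α⁻¹(x))·A(S⁻¹(α(h₁))) is an (A,B)-Yetter-Drinfeld Hom-module. -/
theorem stmt_5 {k : Type*} [Field k] {H : Type*} [AddCommGroup H] [Module k H]
    (HH : HomHopf k H) (A B : H ≃ₗ[k] H)
    (hA : IsHomHopfAuto HH A) (hB : IsHomHopfAuto HH B)
    (act : H →ₗ[k] H →ₗ[k] H)
    (hact : ∀ (h x : H) (n : ℕ) (h1 h2 : Fin n → H),
      HH.comul h = ∑ i, h1 i ⊗ₜ[k] h2 i →
      act h x = ∑ i, HH.mul (HH.mul (B (h2 i)) (HH.a.symm x)) (A (HH.S.symm (HH.a (h1 i))))) :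
    ∃ Y : YDModule HH A B H, Y.act = act ∧ Y.coact = HH.comul ∧ Y.mu = HH.a := by
  exact @IsHopfTwist.exists_ydModule k _ H HH.untwistRing HH.untwistHopfAlgebra HH
    HH.isHopfTwist_untwist A B hA hB act hact
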